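/- Let α > 2 be real, K ≥ 1 a natural number, r > 0, and s ≥ 0 real with s r^{-α} < 1. Then 2 ∫_r^∞ (1 - (1 + s v^{-α})^{-K}) · v dv = r² · ( ₂F₁(K, -2/α; 1 - 2/α; -s r^{-α}) - 1 ), where ₂F₁(a,b;c;z) - 1 is given by the convergent series ∑_{n=1}^∞ [ (a)_n (b)_n / ((c)_n · n!) ] z^n with (x)_n = x(x+1)⋯(x+n-1) the ascending Pochhammer symbol. Equivalently: ∫_r^∞ (1 - (1 + s v^{-α})^{-K}) v dv = (r²/2) ∑_{n=1}^∞ [ (K)_n (-2/α)_n / ((1-2/α)_n n!) ] (-s r^{-α})^n, and the series converges. -/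

import Mathlib

open Real MeasureTheory

lemma aux_poch_ratio (b : ℝ) (n : ℕ) (h : ∀ k : ℕ, 1 + b + k ≠ 0) :
    (ascPochhammer ℝ (n + 1)).eval b / (ascPochhammer ℝ (n + 1)).eval (1 + b)
      = b / (1 + b + n) := by
  induction n with
  | zero => simp
  | succ n ih =>
    rw [ascPochhammer_succ_eval, ascPochhammer_succ_eval (n + 1) (1 + b), mul_div_mul_comm, ih]
    have h1 := h n
    have h2 := h (n + 1)
    push_cast at h2 ⊢
    have e : b + (n + 1) = 1 + b + n := by ring
    rw [e]
    field_simp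

lemma aux_choose (m n : ℕ) :
    (ascPochhammer ℝ n).eval ((m + 1 : ℕ) : ℝ) / (Nat.factorial n : ℝ)
      = ((n + m).choose m : ℝ) := by
  rw [ascPochhammer_nat_eq_natCast_ascFactorial, Nat.ascFactorial_eq_factorial_mul_choose]
  have : (Nat.factorial n : ℝ) ≠ 0 := by positivity
  push_cast
  rw [mul_div_cancel_left₀ _ this, add_comm n m, Nat.choose_symm_add]

lemma aux_series (m : ℕ) (x : ℝ) (h0 : 0 ≤ x) (h1 : x < 1) :
    HasSum (fun n : ℕ => -(((n + 1 + m).choose m : ℝ) * (-x) ^ (n + 1)))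
      (1 - (1 + x)⁻¹ ^ (m + 1)) := by
  have hx : ‖-x‖ < 1 := by rw [norm_neg, Real.norm_of_nonneg h0]; exact h1
  have h := hasSum_choose_mul_geometric_of_norm_lt_one m hx
  rw [← hasSum_nat_add_iff' 1] at h
  have e : 1 - (1 + x)⁻¹ ^ (m + 1) = -(1 / (1 - -x) ^ (m + 1)
      - ∑ i ∈ Finset.range 1, ((i + m).choose m : ℝ) * (-x) ^ i) := by
    simp
  rw [e]
  exact h.neg

/-- Hypergeometric evaluation of the interference integral (Lemma 2 of the paper):
for `α > 2`, `K ≥ 1`, `r > 0`, `0 ≤ s` with `s r^{-α} < 1`,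
`∫_r^∞ (1 - (1 + s v^{-α})^{-K}) v dv
  = (r²/2) ∑_{n=1}^∞ (K)_n (-2/α)_n / ((1-2/α)_n n!) (-s r^{-α})^n`,
where `(x)_n` is the ascending Pochhammer symbol, and the series converges. -/
theorem interference_integral_hypergeometric (α : ℝ) (hα : 2 < α) (K : ℕ) (hK : 1 ≤ K)
    (r : ℝ) (hr : 0 < r) (s : ℝ) (hs : 0 ≤ s) (hsr : s * r ^ (-α) < 1) :
    Summable (fun n : ℕ =>
      (ascPochhammer ℝ (n + 1)).eval (K : ℝ) * (ascPochhammer ℝ (n + 1)).eval (-2 / α)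
        / ((ascPochhammer ℝ (n + 1)).eval (1 - 2 / α) * (Nat.factorial (n + 1) : ℝ))
        * (-(s * r ^ (-α))) ^ (n + 1)) ∧
    (∫ v in Set.Ioi r, (1 - (1 + s * v ^ (-α))⁻¹ ^ K) * v)
      = (r ^ 2 / 2) * ∑' n : ℕ,
          (ascPochhammer ℝ (n + 1)).eval (K : ℝ) * (ascPochhammer ℝ (n + 1)).eval (-2 / α)
            / ((ascPochhammer ℝ (n + 1)).eval (1 - 2 / α) * (Nat.factorial (n + 1) : ℝ))
            * (-(s * r ^ (-α))) ^ (n + 1) := by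
  obtain ⟨m, rfl⟩ : ∃ m, K = m + 1 := ⟨K - 1, by omega⟩
  set x : ℝ := s * r ^ (-α) with hx
  have hα0 : 0 < α := by linarith
  have hx0 : 0 ≤ x := by positivity
  have hpos : ∀ n : ℕ, 0 < α * (n + 1) - 2 := fun n => by
    have : (0:ℝ) ≤ n := n.cast_nonneg
    nlinarith
  have hterm : ∀ n : ℕ, (ascPochhammer ℝ (n + 1)).eval ((m + 1 : ℕ) : ℝ)
        * (ascPochhammer ℝ (n + 1)).eval (-2 / α)
        / ((ascPochhammer ℝ (n + 1)).eval (1 - 2 / α) * (Nat.factorial (n + 1) : ℝ))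
        * (-x) ^ (n + 1)
      = ((n + 1 + m).choose m : ℝ) * (-2 / (α * (n + 1) - 2)) * (-x) ^ (n + 1) := by
    intro n
    have hb : (0:ℝ) < 1 - 2 / α := by
      rw [sub_pos, div_lt_one hα0]; exact hα
    have hne : ∀ k : ℕ, 1 + (-2 / α) + k ≠ 0 := fun k => by
      have : (0:ℝ) ≤ k := k.cast_nonneg
      have e : 1 + (-2 / α) = 1 - 2 / α := by ring
      rw [e]; positivity
    have h1 := aux_poch_ratio (-2 / α) n hne
    have h2 := aux_choose m (n + 1)
    have e : 1 + (-2 / α) = 1 - 2 / α := by ring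
    have h3 : (-2 / α) / (1 + (-2 / α) + n) = -2 / (α * (n + 1) - 2) := by
      have := hne n
      have := hpos n
      rw [div_div]
      congr 1
      field_simp
      ring
    rw [mul_comm ((ascPochhammer ℝ (n + 1)).eval (1 - 2 / α)), mul_div_mul_comm, h2, ← e, h1, h3]
  simp only [hterm]
  have hS := aux_series m x hx0 hsr
  have hrp : ∀ (n : ℕ) (v : ℝ), 0 < v →
      s ^ (n + 1) * v ^ (1 - α * (n + 1)) = (s * v ^ (-α)) ^ (n + 1) * v := by
    intro n v hv
    rw [mul_pow, ← Real.rpow_natCast (v ^ (-α)), ← Real.rpow_mul hv.le, mul_assoc]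
    congr 1
    rw [← Real.rpow_add_one hv.ne']
    congr 1
    push_cast
    ring
  let F : ℕ → ℝ → ℝ := fun n v =>
    (-(((n + 1 + m).choose m : ℝ) * (-1) ^ (n + 1) * s ^ (n + 1))) * v ^ (1 - α * (n + 1))
  have hexp : ∀ n : ℕ, 1 - α * (n + 1) < -1 := fun n => by linarith [hpos n]
  have hFi : ∀ n, Integrable (F n) (volume.restrict (Set.Ioi r)) := fun n =>
    (integrableOn_Ioi_rpow_of_lt (hexp n) hr).const_mul _
  have hI : ∀ n : ℕ, s ^ (n + 1) * (∫ v in Set.Ioi r, v ^ (1 - α * (n + 1)))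
      = x ^ (n + 1) * (r ^ 2 / (α * (n + 1) - 2)) := by
    intro n
    rw [integral_Ioi_rpow_of_lt (hexp n) hr, Real.rpow_add_one hr.ne']
    have h1 := hrp n r hr
    have h2 := hpos n
    have e : 1 - α * ((n:ℝ) + 1) + 1 = -(α * (n + 1) - 2) := by ring
    rw [e, neg_div_neg_eq, ← mul_div_assoc, ← mul_assoc, h1]
    ring
  have hFint : ∀ n, ∫ v in Set.Ioi r, F n v
      = (r ^ 2 / 2) * (((n + 1 + m).choose m : ℝ) * (-2 / (α * (n + 1) - 2)) * (-x) ^ (n + 1)) := by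
    intro n
    simp only [F]
    rw [integral_const_mul, neg_mul, mul_assoc _ (s ^ (n + 1)), hI, neg_pow x]
    ring
  have hFnorm : ∀ n, ∫ v in Set.Ioi r, ‖F n v‖
      = ((n + 1 + m).choose m : ℝ) * (x ^ (n + 1) * (r ^ 2 / (α * (n + 1) - 2))) := by
    intro n
    rw [← hI, ← mul_assoc, ← integral_const_mul]
    refine setIntegral_congr_fun measurableSet_Ioi fun v hv => ?_
    have hv0 : 0 < v := hr.trans hv
    simp only [F, norm_mul, norm_neg, norm_pow, norm_one, one_pow, mul_one]
    rw [Real.norm_of_nonneg hs, Real.norm_of_nonneg (by positivity : 0 ≤ v ^ (1 - α * ((n:ℝ) + 1))),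
      Real.norm_of_nonneg (Nat.cast_nonneg _)]
  have hsum : Summable fun n => ∫ v in Set.Ioi r, ‖F n v‖ := by
    simp only [hFnorm]
    refine Summable.of_nonneg_of_le (fun n => ?_) (fun n => ?_)
      (hS.summable.norm.mul_right (r ^ 2 / (α - 2)))
    · have := hpos n
      positivity
    · rw [norm_neg, norm_mul, norm_pow, norm_neg, Real.norm_of_nonneg hx0,
        Real.norm_of_nonneg (Nat.cast_nonneg _), ← mul_assoc]
      have h2 : 0 < α - 2 := by linarith
      have h3 : α - 2 ≤ α * (n + 1) - 2 := by
        have : (0:ℝ) ≤ n := n.cast_nonneg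
        nlinarith
      gcongr
  have hH := hasSum_integral_of_summable_integral_norm hFi hsum
  have hint : (∫ v in Set.Ioi r, ∑' n, F n v)
      = ∫ v in Set.Ioi r, (1 - (1 + s * v ^ (-α))⁻¹ ^ (m + 1)) * v := by
    refine setIntegral_congr_fun measurableSet_Ioi fun v hv => ?_
    have hv0 : 0 < v := hr.trans hv
    have hle : s * v ^ (-α) ≤ x :=
      mul_le_mul_of_nonneg_left
        (Real.rpow_le_rpow_of_nonpos hr (le_of_lt hv) (by linarith)) hs
    have h := (aux_series m (s * v ^ (-α)) (by positivity) (hle.trans_lt hsr)).mul_right v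
    rw [← h.tsum_eq]
    refine tsum_congr fun n => ?_
    simp only [F]
    have := hrp n v hv0
    rw [neg_mul, mul_assoc _ (s ^ (n + 1)), this, neg_pow (s * v ^ (-α))]
    ring
  rw [hint] at hH
  simp only [hFint] at hH
  have hr2 : r ^ 2 / 2 ≠ 0 := by positivity
  refine ⟨(summable_mul_left_iff hr2).1 hH.summable, ?_⟩
  rw [← tsum_mul_left]
  exact hH.tsum_eq.symm
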